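/- Let F : C ⥤ D and G : D ⥤ C be functors with an adjunction adj : F ⊣ G. Then adj is monadic — i.e., the comparison functor Monad.comparison adj : D ⥤ (adj.toMonad).Algebra is an equivalence of categories — if and only if for every category W the induced adjunction between the functor categories W ⥤ C and W ⥤ D, whose left and right adjoints are post-composition with F and with G respectively (with unit and counit obtained by whiskering those of adj), is monadic. -/

import Mathlib

open CategoryTheory

universe v₁ u₁ v₂ u₂ v₃ u₃

namespace CategoryTheory

open CategoryTheory.Functor

section Whiskering

variable {C : Type u₁} [Category.{v₁} C] {D : Type u₂} [Category.{v₂} D]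

/-- Post-composition with an equivalence is an equivalence of functor categories. -/
lemma isEquivalence_whiskeringRight_obj (W : Type u₃) [Category.{v₃} W] (K : C ⥤ D)
    [K.IsEquivalence] : ((whiskeringRight W C D).obj K).IsEquivalence :=
  K.asEquivalence.congrRight.isEquivalence_functor

/-- A functor is an equivalence if post-composition with it is an equivalence between
categories of functors out of a terminal category. -/
lemma isEquivalence_of_whiskeringRight_obj {W : Type u₃} [Category.{v₃} W]
    (e : W ≌ Discrete PUnit.{1}) (K : C ⥤ D)
    [((whiskeringRight W C D).obj K).IsEquivalence] : K.IsEquivalence := by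
  let evalC : (W ⥤ C) ≌ C := e.congrLeft.trans Functor.equiv
  let evalD : (W ⥤ D) ≌ D := e.congrLeft.trans Functor.equiv
  let i : evalC.functor ⋙ K ≅ (whiskeringRight W C D).obj K ⋙ evalD.functor :=
    NatIso.ofComponents (fun _ ↦ Iso.refl _) fun _ ↦
      (Category.comp_id _).trans (Category.id_comp _).symm
  have := isEquivalence_of_iso i.symm
  exact isEquivalence_of_comp_left evalC.functor K

end Whiskering

namespace Adjunction

variable {C : Type u₁} [Category.{v₁} C] {D : Type u₂} [Category.{v₂} D]
  {F : C ⥤ D} {G : D ⥤ C} (adj : F ⊣ G) (W : Type u₃) [Category.{v₃} W]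

lemma toMonad_whiskerRight_η_app_app (X : W ⥤ C) (w : W) :
    ((Adjunction.whiskerRight W adj).toMonad.η.app X).app w =
      adj.toMonad.η.app (X.obj w) :=
  Adjunction.whiskerRight_unit_app_app W adj X w

lemma toMonad_whiskerRight_μ_app_app (X : W ⥤ C) (w : W) :
    ((Adjunction.whiskerRight W adj).toMonad.μ.app X).app w =
      adj.toMonad.μ.app (X.obj w) :=
  congrArg G.map (Adjunction.whiskerRight_counit_app_app W adj (X ⋙ F) w)

/-- A functor valued in algebras for `adj.toMonad` is an algebra for the monad induced on the
functor category. -/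
def algebraOfFunctor (K : W ⥤ adj.toMonad.Algebra) :
    (Adjunction.whiskerRight W adj).toMonad.Algebra where
  A := K ⋙ adj.toMonad.forget
  a := { app := fun w ↦ (K.obj w).a, naturality := fun _ _ f ↦ (K.map f).h }
  unit := by
    ext w
    exact (congrArg (· ≫ (K.obj w).a) (toMonad_whiskerRight_η_app_app adj W _ w)).trans
      (K.obj w).unit
  assoc := by
    ext w
    exact (congrArg (· ≫ (K.obj w).a) (toMonad_whiskerRight_μ_app_app adj W _ w)).trans
      (K.obj w).assoc

/-- The functor underlying an algebra for the monad induced on the functor category, lifted to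
algebras for `adj.toMonad`. -/
def functorOfAlgebra (X : (Adjunction.whiskerRight W adj).toMonad.Algebra) :
    W ⥤ adj.toMonad.Algebra where
  obj w :=
    { A := X.A.obj w
      a := X.a.app w
      unit := (congrArg (· ≫ X.a.app w) (toMonad_whiskerRight_η_app_app adj W X.A w)).symm.trans
        (NatTrans.congr_app X.unit w)
      assoc := (congrArg (· ≫ X.a.app w) (toMonad_whiskerRight_μ_app_app adj W X.A w)).symm.trans
        (NatTrans.congr_app X.assoc w) }
  map f :=
    { f := X.A.map f
      h := X.a.naturality f }

/-- The comparison from functors valued in algebras to algebras in the functor category. -/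
def functorToAlgebra :
    (W ⥤ adj.toMonad.Algebra) ⥤ (Adjunction.whiskerRight W adj).toMonad.Algebra where
  obj K := algebraOfFunctor adj W K
  map τ :=
    { f := Functor.whiskerRight τ adj.toMonad.forget
      h := by
        ext w
        exact (τ.app w).h }

instance : (functorToAlgebra adj W).Faithful where
  map_injective h := by
    ext w
    exact NatTrans.congr_app (congrArg Monad.Algebra.Hom.f h) w

instance : (functorToAlgebra adj W).Full where
  map_surjective φ :=
    ⟨{ app := fun w ↦ { f := φ.f.app w, h := NatTrans.congr_app φ.h w }
       naturality := fun _ _ f ↦ Monad.Algebra.Hom.ext (φ.f.naturality f) }, rfl⟩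

instance : (functorToAlgebra adj W).EssSurj where
  mem_essImage X :=
    ⟨functorOfAlgebra adj W X,
      ⟨Monad.Algebra.isoMk (Iso.refl X.A)
        ((congrArg (· ≫ X.a) (Functor.map_id _ X.A)).trans
          ((Category.id_comp X.a).trans (Category.comp_id X.a).symm))⟩⟩

instance : (functorToAlgebra adj W).IsEquivalence where

/-- The comparison functor of the induced adjunction on functor categories factors through
post-composition with the comparison functor of the original adjunction. -/
def whiskeringRightComparisonIso :
    (whiskeringRight W D adj.toMonad.Algebra).obj (Monad.comparison adj) ⋙
        functorToAlgebra adj W ≅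
      Monad.comparison (Adjunction.whiskerRight W adj) :=
  NatIso.ofComponents
    (fun K ↦ Monad.Algebra.isoMk (Iso.refl (K ⋙ G)) (by
      ext w
      have h := Adjunction.whiskerRight_counit_app_app W adj K w
      exact (congrArg (· ≫ G.map (((Adjunction.whiskerRight W adj).counit.app K).app w))
        (adj.toMonad.map_id (G.obj (K.obj w)))).trans
        ((Category.id_comp _).trans ((congrArg G.map h).trans (Category.comp_id _).symm))))
    (fun τ ↦ Monad.Algebra.Hom.ext ((Category.comp_id (Functor.whiskerRight τ G)).trans
      (Category.id_comp _).symm))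

lemma isEquivalence_comparison_whiskerRight_iff :
    (Monad.comparison (Adjunction.whiskerRight W adj)).IsEquivalence ↔
      ((whiskeringRight W D adj.toMonad.Algebra).obj (Monad.comparison adj)).IsEquivalence := by
  refine ⟨fun _ ↦ ?_, fun _ ↦ isEquivalence_of_iso (whiskeringRightComparisonIso adj W)⟩
  have := isEquivalence_of_iso (whiskeringRightComparisonIso adj W).symm
  exact isEquivalence_of_comp_right _ (functorToAlgebra adj W)

end Adjunction

end CategoryTheory

/-- An adjunction `adj : F ⊣ G` is monadic (its comparison functor
`Monad.comparison adj : D ⥤ (adj.toMonad).Algebra` is an equivalence) if and only if for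
every category `W` the induced adjunction between the functor categories `W ⥤ C` and
`W ⥤ D`, given by post-composition with `F` and `G` (with unit and counit obtained by
whiskering those of `adj`), is monadic. -/
theorem monadic_iff_representably_monadic {C : Type u₁} [Category.{v₁} C]
    {D : Type u₂} [Category.{v₂} D] {F : C ⥤ D} {G : D ⥤ C} (adj : F ⊣ G) :
    (Monad.comparison adj).IsEquivalence ↔
      ∀ (W : Type u₃) [Category.{v₃} W],
        (Monad.comparison (Adjunction.whiskerRight W adj)).IsEquivalence := by
  refine ⟨fun _ W _ ↦ (adj.isEquivalence_comparison_whiskerRight_iff W).2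
    (isEquivalence_whiskeringRight_obj W _), fun h ↦ ?_⟩
  let _ : Category (ULift.{u₃} (Discrete PUnit.{1})) := uliftCategory _
  let W := ULiftHom.{v₃} (ULift.{u₃} (Discrete PUnit.{1}))
  let e : W ≌ Discrete PUnit.{1} := (ULift.equivalence.trans ULiftHom.equiv).symm
  have := (adj.isEquivalence_comparison_whiskerRight_iff W).1 (h W)
  exact isEquivalence_of_whiskeringRight_obj e _
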